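/- Let k be a field, A a finite-dimensional k-algebra, and S, T two non-isomorphic simple A-modules. Then Ext¹_A(T,S) = 0 if and only if for every finite-dimensional A-module M there is an A-module isomorphism P_T(P_S(M)) ≅ P_{S⊕T}(M). -/

import Mathlib

/-- The trace `t_U(M)` of a module `U` in a module `M`: the largest submodule of `M`
generated by homomorphic images of `U`. -/
def moduleTrace (A : Type) [Ring A] (U : Type) [AddCommGroup U] [Module A U]
    (M : Type) [AddCommGroup M] [Module A M] : Submodule A M :=
  ⨆ f : U →ₗ[A] M, LinearMap.range f

/-- The projection functor on objects: `P_U(M) = M ⧸ t_U(M)`. -/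
abbrev moduleProj (A : Type) [Ring A] (U : Type) [AddCommGroup U] [Module A U]
    (M : Type) [AddCommGroup M] [Module A M] : Type :=
  M ⧸ moduleTrace A U M

section ModuleTrace

variable {A : Type} [Ring A] {M N P S T U : Type}
  [AddCommGroup M] [Module A M] [AddCommGroup N] [Module A N] [AddCommGroup P] [Module A P]
  [AddCommGroup S] [Module A S] [AddCommGroup T] [Module A T] [AddCommGroup U] [Module A U]

theorem range_le_moduleTrace (f : U →ₗ[A] M) : LinearMap.range f ≤ moduleTrace A U M :=
  le_iSup (fun f : U →ₗ[A] M => LinearMap.range f) f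

theorem map_moduleTrace_le (g : M →ₗ[A] N) :
    (moduleTrace A U M).map g ≤ moduleTrace A U N := by
  rw [moduleTrace, Submodule.map_iSup]
  refine iSup_le fun f => ?_
  rw [← LinearMap.range_comp]
  exact range_le_moduleTrace _

theorem moduleTrace_prod :
    moduleTrace A (S × T) M = moduleTrace A S M ⊔ moduleTrace A T M := by
  refine le_antisymm (iSup_le fun f => ?_) (sup_le (iSup_le fun f => ?_) (iSup_le fun f => ?_))
  · rw [← LinearMap.coprod_comp_inl_inr f, LinearMap.range_coprod]
    exact sup_le_sup (range_le_moduleTrace _) (range_le_moduleTrace _)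
  · simpa [LinearMap.range_coprod] using range_le_moduleTrace (f.coprod (0 : T →ₗ[A] M))
  · simpa [LinearMap.range_coprod] using range_le_moduleTrace ((0 : S →ₗ[A] M).coprod f)

theorem moduleTrace_eq_isotypicComponent [IsSimpleModule A S] :
    moduleTrace A S M = isotypicComponent A M S := by
  refine le_antisymm (iSup_le fun f => ?_) (sSup_le ?_)
  · rcases LinearMap.injective_or_eq_zero f with hf | rfl
    · exact le_sSup ⟨(LinearEquiv.ofInjective f hf).symm⟩
    · simp
  · rintro m ⟨e⟩
    simpa [LinearMap.range_comp] using
      range_le_moduleTrace (m.subtype ∘ₗ (e.symm : S →ₗ[A] m))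

theorem moduleTrace_eq_bot_of_isSimpleModule [IsSimpleModule A S] [IsSimpleModule A T]
    (hne : IsEmpty (S ≃ₗ[A] T)) : moduleTrace A S T = ⊥ := by
  refine iSup_eq_bot.mpr fun f => ?_
  rcases LinearMap.bijective_or_eq_zero f with hf | rfl
  · exact (hne.false (LinearEquiv.ofBijective f hf)).elim
  · simp

theorem exists_linearEquiv_moduleTrace [IsSimpleModule A S] [IsNoetherian A M] :
    ∃ n : ℕ, Nonempty (moduleTrace A S M ≃ₗ[A] (Fin n → S)) := by
  rw [moduleTrace_eq_isotypicComponent]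
  exact (IsIsotypicOfType.isotypicComponent A M S).linearEquiv_fun

/-- The trace of `S × T` is contained in the kernel of `M → P_S(M) → P_T(P_S(M))`. -/
theorem moduleTrace_prod_le_comap :
    moduleTrace A (S × T) M ≤
      (moduleTrace A T (moduleProj A S M)).comap (moduleTrace A S M).mkQ := by
  rw [moduleTrace_prod]
  refine sup_le ?_ (Submodule.map_le_iff_le_comap.mp (map_moduleTrace_le _))
  exact (moduleTrace A S M).le_comap_mkQ _

variable (A S T M) in
/-- The iterated projection `P_T(P_S(M))` as a single quotient of `M`. -/
noncomputable def moduleProjCompEquiv :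
    moduleProj A T (moduleProj A S M) ≃ₗ[A]
      M ⧸ (moduleTrace A T (moduleProj A S M)).comap (moduleTrace A S M).mkQ :=
  (Submodule.quotEquivOfEq _ _
    (Submodule.map_comap_eq_of_surjective (Submodule.mkQ_surjective _) _).symm).trans
    (Submodule.quotientQuotientEquivQuotient _ _ (Submodule.le_comap_mkQ _ _))

/-- A homomorphism `T → M ⧸ X` lifts to `M` when homomorphisms to `X` from the kernel of
a surjection `P → T` with `P` projective extend to `P`. -/
theorem exists_lift_mkQ [Module.Projective A P] {p : P →ₗ[A] T} (hp : Function.Surjective p)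
    {X : Submodule A M}
    (hX : ∀ g : LinearMap.ker p →ₗ[A] X, ∃ h : P →ₗ[A] X, h ∘ₗ (LinearMap.ker p).subtype = g)
    (f : T →ₗ[A] M ⧸ X) : ∃ f' : T →ₗ[A] M, X.mkQ ∘ₗ f' = f := by
  obtain ⟨F, hF⟩ := Module.projective_lifting_property X.mkQ (f ∘ₗ p) X.mkQ_surjective
  have hFX (x : LinearMap.ker p) : (F ∘ₗ (LinearMap.ker p).subtype) x ∈ X := by
    have := LinearMap.congr_fun hF x
    rw [← Submodule.Quotient.mk_eq_zero]
    simpa using this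
  obtain ⟨h, hh⟩ := hX ((F ∘ₗ (LinearMap.ker p).subtype).codRestrict X hFX)
  have hker : LinearMap.ker p ≤ LinearMap.ker (F - X.subtype ∘ₗ h) := fun x hx => by
    have := LinearMap.congr_fun hh ⟨x, hx⟩
    simp only [LinearMap.comp_apply, Submodule.subtype_apply] at this
    simp [this]
  let e := p.quotKerEquivOfSurjective hp
  refine ⟨(LinearMap.ker p).liftQ _ hker ∘ₗ (e.symm : T →ₗ[A] _), ?_⟩
  refine LinearMap.ext fun t => ?_
  obtain ⟨x, rfl⟩ := hp t
  have he : e.symm (p x) = Submodule.Quotient.mk x := by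
    rw [LinearEquiv.symm_apply_eq]
    rfl
  have := LinearMap.congr_fun hF x
  simp only [LinearMap.comp_apply] at this
  simp [he, ← this]

theorem exists_extension_of_linearEquiv_fun {K : Submodule A P} {n : ℕ} (e : N ≃ₗ[A] (Fin n → S))
    (hS : ∀ g : K →ₗ[A] S, ∃ h : P →ₗ[A] S, h ∘ₗ K.subtype = g) (g : K →ₗ[A] N) :
    ∃ h : P →ₗ[A] N, h ∘ₗ K.subtype = g := by
  choose h hh using fun i => hS (LinearMap.proj i ∘ₗ (e : N →ₗ[A] (Fin n → S)) ∘ₗ g)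
  refine ⟨(e.symm : _ →ₗ[A] N) ∘ₗ LinearMap.pi h, LinearMap.ext fun x => ?_⟩
  simp only [LinearMap.comp_apply, LinearEquiv.coe_coe, LinearEquiv.symm_apply_eq]
  exact funext fun i => LinearMap.congr_fun (hh i) x

theorem comap_moduleTrace_eq_moduleTrace_prod [IsSimpleModule A S] [IsNoetherian A M]
    [Module.Projective A P] {p : P →ₗ[A] T} (hp : Function.Surjective p)
    (hS : ∀ g : LinearMap.ker p →ₗ[A] S, ∃ h : P →ₗ[A] S, h ∘ₗ (LinearMap.ker p).subtype = g) :
    (moduleTrace A T (moduleProj A S M)).comap (moduleTrace A S M).mkQ =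
      moduleTrace A (S × T) M := by
  refine le_antisymm ?_ moduleTrace_prod_le_comap
  obtain ⟨n, ⟨e⟩⟩ := exists_linearEquiv_moduleTrace (A := A) (S := S) (M := M)
  have hle : moduleTrace A T (moduleProj A S M) ≤
      (moduleTrace A T M).map (moduleTrace A S M).mkQ := by
    refine iSup_le fun f => ?_
    obtain ⟨f', rfl⟩ := exists_lift_mkQ hp (exists_extension_of_linearEquiv_fun e hS) f
    rw [LinearMap.range_comp]
    exact Submodule.map_mono (range_le_moduleTrace f')
  refine (Submodule.comap_mono hle).trans ?_
  rw [Submodule.comap_map_eq, Submodule.ker_mkQ, moduleTrace_prod, sup_comm]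

/-- An extension of `T` by `S` splits as soon as it is generated by the traces of `S` and `T`. -/
theorem exists_retraction_of_moduleTrace_prod_eq_top [IsSimpleModule A S] [IsSimpleModule A T]
    (hne : IsEmpty (S ≃ₗ[A] T)) {i : S →ₗ[A] M} (hi : Function.Injective i) {q : M →ₗ[A] T}
    (hiq : Function.Exact i q) (hq : q ≠ 0) (htop : moduleTrace A (S × T) M = ⊤) :
    ∃ r : M →ₗ[A] S, r ∘ₗ i = LinearMap.id := by
  have hSq : moduleTrace A S M ≤ LinearMap.ker q := by
    rw [LinearMap.le_ker_iff_map, ← le_bot_iff, ← moduleTrace_eq_bot_of_isSimpleModule hne]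
    exact map_moduleTrace_le q
  have hTq : ∃ f : T →ₗ[A] M, q ∘ₗ f ≠ 0 := by
    by_contra! h
    refine hq (LinearMap.ker_eq_top.mp (top_le_iff.mp ?_))
    rw [← htop, moduleTrace_prod]
    exact sup_le hSq (iSup_le fun f => LinearMap.range_le_ker_iff.mpr (h f))
  obtain ⟨f, hf⟩ := hTq
  let e := LinearEquiv.ofBijective _ ((LinearMap.bijective_or_eq_zero (q ∘ₗ f)).resolve_right hf)
  let j := f ∘ₗ (e.symm : T →ₗ[A] T)
  have hj : q ∘ₗ j = LinearMap.id := LinearMap.ext fun t => e.apply_symm_apply t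
  have hr (x : M) : (LinearMap.id - j ∘ₗ q : M →ₗ[A] M) x ∈ LinearMap.range i := by
    obtain ⟨s, hs⟩ := (hiq ((LinearMap.id - j ∘ₗ q : M →ₗ[A] M) x)).mp (by
      have := LinearMap.congr_fun hj (q x)
      simp only [LinearMap.comp_apply] at this
      simp [this])
    exact ⟨s, hs⟩
  let e' := LinearEquiv.ofInjective i hi
  refine ⟨(e'.symm : _ →ₗ[A] S) ∘ₗ (LinearMap.id - j ∘ₗ q).codRestrict _ hr,
    LinearMap.ext fun s => ?_⟩
  simp only [LinearMap.comp_apply, LinearEquiv.coe_coe, LinearEquiv.symm_apply_eq]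
  ext
  simp [e', hiq.apply_apply_eq_zero]

/-- For an extension of `T` by `S`, the iterated projection vanishes. -/
theorem comap_moduleTrace_eq_top_of_exact {i : S →ₗ[A] M} {q : M →ₗ[A] T}
    (hiq : Function.Exact i q) (hq : Function.Surjective q) :
    (moduleTrace A T (moduleProj A S M)).comap (moduleTrace A S M).mkQ = ⊤ := by
  have hker : LinearMap.ker q ≤ LinearMap.ker (moduleTrace A S M).mkQ := by
    rw [hiq.linearMap_ker_eq, Submodule.ker_mkQ]
    exact range_le_moduleTrace i
  let e := q.quotKerEquivOfSurjective hq
  let f : T →ₗ[A] moduleProj A S M := (LinearMap.ker q).liftQ _ hker ∘ₗ (e.symm : T →ₗ[A] _)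
  have hf (x : M) : f (q x) = (moduleTrace A S M).mkQ x := by
    have he : e.symm (q x) = Submodule.Quotient.mk x := by
      rw [LinearEquiv.symm_apply_eq]
      rfl
    simp [f, he]
  rw [eq_top_iff]
  intro x _
  rw [Submodule.mem_comap, ← hf]
  exact range_le_moduleTrace f ⟨_, rfl⟩

/-- Pushing out `0 → ker p → P → T → 0` along `g : ker p → S` yields an extension of `T` by `S`,
whose retractions onto `S` extend `g` to `P`. -/
theorem exists_exact_of_ker_hom {p : P →ₗ[A] T} (hp : Function.Surjective p)
    (g : LinearMap.ker p →ₗ[A] S) :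
    ∃ (W : Submodule A (P × S)) (i : S →ₗ[A] (P × S) ⧸ W) (q : ((P × S) ⧸ W) →ₗ[A] T)
      (j : P →ₗ[A] (P × S) ⧸ W), Function.Injective i ∧ Function.Exact i q ∧
      Function.Surjective q ∧ j ∘ₗ (LinearMap.ker p).subtype = i ∘ₗ g := by
  let W := LinearMap.range ((LinearMap.ker p).subtype.prod (-g))
  have hW : W ≤ LinearMap.ker (p ∘ₗ LinearMap.fst A P S) := by
    rintro _ ⟨x, rfl⟩
    simp
  refine ⟨W, W.mkQ ∘ₗ LinearMap.inr A P S, W.liftQ _ hW, W.mkQ ∘ₗ LinearMap.inl A P S,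
    ?_, ?_, ?_, ?_⟩
  · rw [injective_iff_map_eq_zero]
    intro s hs
    obtain ⟨x, hx⟩ := (Submodule.Quotient.mk_eq_zero W).mp hs
    obtain ⟨h₁, h₂⟩ := Prod.ext_iff.mp hx
    obtain rfl : x = 0 := Subtype.ext h₁
    simpa using h₂.symm
  · intro y
    obtain ⟨⟨x, s⟩, rfl⟩ := W.mkQ_surjective y
    constructor
    · intro hy
      have hx : x ∈ LinearMap.ker p := by simpa using hy
      refine ⟨s + g ⟨x, hx⟩, ?_⟩
      refine (Submodule.Quotient.eq W).mpr ⟨-⟨x, hx⟩, ?_⟩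
      simp
    · rintro ⟨t, ht⟩
      rw [← ht]
      simp
  · intro t
    obtain ⟨x, rfl⟩ := hp t
    exact ⟨W.mkQ (x, 0), by simp⟩
  · refine LinearMap.ext fun x => ?_
    refine (Submodule.Quotient.eq W).mpr ⟨x, ?_⟩
    simp

theorem exists_extension_of_nonempty_moduleProj_equiv (k : Type) [Field k] [Algebra k A]
    [FiniteDimensional k A] [IsSimpleModule A S] [IsSimpleModule A T]
    (hne : IsEmpty (S ≃ₗ[A] T))
    (H : ∀ (M : Type) [AddCommGroup M] [Module A M] [Module k M] [IsScalarTower k A M]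
      [FiniteDimensional k M],
      Nonempty (moduleProj A T (moduleProj A S M) ≃ₗ[A] moduleProj A (S × T) M))
    {p : P →ₗ[A] T} (hp : Function.Surjective p) (g : LinearMap.ker p →ₗ[A] S) :
    ∃ h : P →ₗ[A] S, h ∘ₗ (LinearMap.ker p).subtype = g := by
  obtain ⟨W, i, q, j, hi, hiq, hq, hj⟩ := exists_exact_of_ker_hom hp g
  let E := (P × S) ⧸ W
  let _ : Module k E := Module.compHom E (algebraMap k A)
  have : IsScalarTower k A E := ⟨fun a b x => by
    rw [Algebra.smul_def, mul_smul]
    rfl⟩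
  have : Module.Finite A E := Module.Finite.of_exact hiq hq
  have : FiniteDimensional k E := Module.Finite.trans A E
  obtain ⟨e⟩ := H E
  have : Subsingleton (E ⧸ (moduleTrace A T (moduleProj A S E)).comap (moduleTrace A S E).mkQ) :=
    Submodule.Quotient.subsingleton_iff.mpr (comap_moduleTrace_eq_top_of_exact hiq hq)
  have : Subsingleton (moduleProj A (S × T) E) :=
    (e.symm.trans (moduleProjCompEquiv A E S T)).toEquiv.subsingleton
  have hq₀ : q ≠ 0 := by
    rintro rfl
    have := IsSimpleModule.nontrivial A T
    obtain ⟨t, ht⟩ := exists_ne (0 : T)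
    obtain ⟨x, hx⟩ := hq t
    exact ht hx.symm
  obtain ⟨r, hr⟩ := exists_retraction_of_moduleTrace_prod_eq_top hne hi hiq hq₀
    (Submodule.Quotient.subsingleton_iff.mp this)
  refine ⟨r ∘ₗ j, ?_⟩
  rw [LinearMap.comp_assoc, hj, ← LinearMap.comp_assoc, hr, LinearMap.id_comp]

end ModuleTrace

open CategoryTheory in
theorem subsingleton_ext_one_iff (k : Type) [Field k] (A : Type) [Ring A] [Algebra k A]
    {X : ModuleCat A} (R : ProjectiveResolution X) (Y : ModuleCat A) :
    Subsingleton (((Ext k (ModuleCat A) 1).obj (Opposite.op X)).obj Y) ↔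
      ∀ g : LinearMap.ker (R.π.f 0).hom →ₗ[A] Y, ∃ h : R.complex.X 0 →ₗ[A] Y,
        h ∘ₗ (LinearMap.ker (R.π.f 0).hom).subtype = g := by
  rw [← ModuleCat.isZero_iff_subsingleton, (R.isoExt 1 Y).isZero_iff,
    ← HomologicalComplex.exactAt_iff_isZero_homology,
    HomologicalComplex.exactAt_iff' _ 0 1 2 (by simp) (by simp),
    ShortComplex.moduleCat_exact_iff]
  have h₀ : LinearMap.range (R.complex.d 1 0).hom = LinearMap.ker (R.π.f 0).hom :=
    R.exact₀.moduleCat_range_eq_ker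
  have h₁ : LinearMap.range (R.complex.d 2 1).hom = LinearMap.ker (R.complex.d 1 0).hom :=
    (R.exact_succ 0).moduleCat_range_eq_ker
  let d : R.complex.X 1 →ₗ[A] LinearMap.ker (R.π.f 0).hom :=
    (R.complex.d 1 0).hom.codRestrict _ fun x => h₀ ▸ ⟨x, rfl⟩
  have hd : Function.Surjective d := fun ⟨y, hy⟩ => by
    obtain ⟨x, rfl⟩ := h₀.symm ▸ hy
    exact ⟨x, rfl⟩
  have hker : LinearMap.ker d = LinearMap.range (R.complex.d 2 1).hom := by
    rw [h₁, LinearMap.ker_codRestrict]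
  have hcocycle (c : R.complex.X 1 ⟶ Y) :
      R.complex.d 2 1 ≫ c = 0 ↔ LinearMap.ker d ≤ LinearMap.ker c.hom := by
    rw [hker, LinearMap.range_le_ker_iff, ModuleCat.hom_ext_iff]
    rfl
  change (∀ c : R.complex.X 1 ⟶ Y, R.complex.d 2 1 ≫ c = 0 →
    ∃ b : R.complex.X 0 ⟶ Y, R.complex.d 1 0 ≫ b = c) ↔ _
  constructor
  · intro H g
    obtain ⟨b, hb⟩ := H (ModuleCat.ofHom (g ∘ₗ d))
      ((hcocycle _).mpr (LinearMap.ker_le_ker_comp d g))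
    refine ⟨b.hom, LinearMap.ext fun y => ?_⟩
    obtain ⟨x, rfl⟩ := hd y
    exact LinearMap.congr_fun (ModuleCat.hom_ext_iff.mp hb) x
  · intro H c hc
    let e := d.quotKerEquivOfSurjective hd
    obtain ⟨h, hh⟩ := H ((LinearMap.ker d).liftQ c.hom ((hcocycle c).mp hc) ∘ₗ
      (e.symm : LinearMap.ker (R.π.f 0).hom →ₗ[A] _))
    refine ⟨ModuleCat.ofHom h, ModuleCat.hom_ext (LinearMap.ext fun x => ?_)⟩
    have he : e.symm (d x) = Submodule.Quotient.mk x := by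
      rw [LinearEquiv.symm_apply_eq]
      rfl
    refine (LinearMap.congr_fun hh (d x)).trans ?_
    rw [LinearMap.comp_apply, LinearEquiv.coe_coe, he, Submodule.liftQ_apply]

open CategoryTheory in
/-- Let `k` be a field, `A` a finite-dimensional `k`-algebra, and
`S`, `T` two non-isomorphic simple `A`-modules.  Then `Ext¹_A(T,S) = 0` if and only if
for every finite-dimensional `A`-module `M` there is an `A`-module isomorphism
`P_T(P_S(M)) ≅ P_{S⊕T}(M)` (the direct sum `S ⊕ T` being realized as `S × T`). -/
theorem ext_vanishes_iff_proj_comp (k : Type) [Field k] (A : Type) [Ring A]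
    [Algebra k A] [FiniteDimensional k A]
    (S : Type) [AddCommGroup S] [Module A S] [Module k S] [IsScalarTower k A S]
    [FiniteDimensional k S] (hS : IsSimpleModule A S)
    (T : Type) [AddCommGroup T] [Module A T] [Module k T] [IsScalarTower k A T]
    [FiniteDimensional k T] (hT : IsSimpleModule A T)
    (hne : IsEmpty (S ≃ₗ[A] T)) :
    Subsingleton (((Ext k (ModuleCat A) 1).obj
        (Opposite.op (ModuleCat.of A T))).obj (ModuleCat.of A S)) ↔
    ∀ (M : Type) [AddCommGroup M] [Module A M] [Module k M] [IsScalarTower k A M]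
      [FiniteDimensional k M],
      Nonempty (moduleProj A T (moduleProj A S M) ≃ₗ[A] moduleProj A (S × T) M) := by
  let R := ProjectiveResolution.of (ModuleCat.of A T)
  let p : R.complex.X 0 →ₗ[A] T := (R.π.f 0).hom
  have hp : Function.Surjective p :=
    (ModuleCat.epi_iff_surjective (R.π.f 0)).mp inferInstance
  have : Module.Projective A (R.complex.X 0) :=
    (IsProjective.iff_projective _).mpr (R.projective 0)
  rw [subsingleton_ext_one_iff k A R (ModuleCat.of A S)]
  constructor
  · intro hExt M _ _ _ _ _
    have : IsNoetherian A M := isNoetherian_of_tower k inferInstance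
    exact ⟨(moduleProjCompEquiv A M S T).trans (Submodule.quotEquivOfEq _ _
      (comap_moduleTrace_eq_moduleTrace_prod hp hExt))⟩
  · intro H
    exact exists_extension_of_nonempty_moduleProj_equiv k hne H hp
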